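/- (Comparison of solutions with different terminal points.) Let $\gamma:=\frac{\lambda}{\lambda-1}$ and $\Psi(y):=\frac{\lambda-1}{\phi_0}(y-\phi_0)$. Let $\gamma\phi_0<\bar y'<\bar y<\phi_0$, and for $i\in\{\bar y,\bar y'\}$ let $(\varphi_i,\psi_i)$ be the $C^1$ solution of the system $\varphi'=g_1(y,\varphi,\psi)$, $\psi'=g_2(y,\varphi,\psi)$ with terminal conditions $\varphi_i(i)=\phi_0$, $\psi_i(i)=\Psi(i)$, defined on its maximal interval of existence $(\epsilon(i),i]$ inside the domain $\mathcal{D}=\{(y,\varphi,\psi):y>0,\varphi>0,0<\psi<1\}$. If $\epsilon(\bar y)<\bar y'$, then $\varphi_{\bar y'}(y)>\varphi_{\bar y}(y)$ and $\psi_{\bar y'}(y)>\psi_{\bar y}(y)$ for all $y$ with $\max\{\epsilon(\bar y),\epsilon(\bar y')\}<y\le\bar y'$. -/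

import Mathlib

open Filter Set Topology

/-- The class `𝒰` of utility functions. -/
structure UtilityClass (f f' f'' : ℝ → ℝ) : Prop where
  hasDeriv : ∀ x > 0, HasDerivAt f (f' x) x
  hasDeriv2 : ∀ x > 0, HasDerivAt f' (f'' x) x
  deriv_pos : ∀ x > 0, 0 < f' x
  deriv2_neg : ∀ x > 0, f'' x < 0
  deriv2_cont : ContinuousOn f'' (Set.Ioi 0)
  tendsto_deriv : Filter.Tendsto f' Filter.atTop (nhds 0)
  map_zero : f 0 = 0

/-- The value `f'(0)` as the right-limit at `0`, as an extended real. -/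
noncomputable def derivAtZero (f' : ℝ → ℝ) : EReal :=
  Filter.limsup (fun x => ((f' x : ℝ) : EReal)) (nhdsWithin 0 (Set.Ioi 0))

/-- A function with `f' < N f` satisfies the reversed Gronwall inequality, strictly. -/
theorem mul_exp_lt_of_deriv_lt_mul {f f' : ℝ → ℝ} {a b N : ℝ} (hab : a < b)
    (hc : ContinuousOn f (Icc a b)) (hd : ∀ y ∈ Ioo a b, HasDerivAt f (f' y) y)
    (hlt : ∀ y ∈ Ioo a b, f' y < N * f y) :
    f b * Real.exp (-N * b) < f a * Real.exp (-N * a) := by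
  have hanti : StrictAntiOn (fun y => f y * Real.exp (-N * y)) (Icc a b) := by
    refine strictAntiOn_of_hasDerivWithinAt_neg (convex_Icc a b)
      (f' := fun y => f' y * Real.exp (-N * y) + f y * (Real.exp (-N * y) * (-N * 1)))
      (hc.mul (by fun_prop)) ?_ ?_
    · intro y hy
      rw [interior_Icc] at hy ⊢
      exact ((hd y hy).mul (((hasDerivAt_id y).const_mul (-N)).exp)).hasDerivWithinAt
    · intro y hy
      rw [interior_Icc] at hy
      nlinarith [hlt y hy, Real.exp_pos (-N * y)]
  exact hanti (left_mem_Icc.2 hab.le) (right_mem_Icc.2 hab.le) hab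

/-- Backward invariance of the positive quadrant under linear differential inequalities. -/
theorem pos_of_pos_right {u v u' v' : ℝ → ℝ} {a b N : ℝ} (hab : a ≤ b)
    (hu : ∀ y ∈ Icc a b, HasDerivAt u (u' y) y) (hv : ∀ y ∈ Icc a b, HasDerivAt v (v' y) y)
    (hlt : ∀ y ∈ Ioo a b, 0 < u y → 0 < v y → u' y < N * u y ∧ v' y < N * v y)
    (hub : 0 < u b) (hvb : 0 < v b) : 0 < u a ∧ 0 < v a := by
  have hcu : ContinuousOn u (Icc a b) := fun y hy => (hu y hy).continuousAt.continuousWithinAt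
  have hcv : ContinuousOn v (Icc a b) := fun y hy => (hv y hy).continuousAt.continuousWithinAt
  by_contra hcon
  have hcon' : min (u a) (v a) ≤ 0 := by
    by_contra h
    exact hcon (lt_min_iff.1 (not_le.1 h))
  have hcomp : IsCompact (Icc a b ∩ (fun y => min (u y) (v y)) ⁻¹' Iic 0) :=
    isCompact_Icc.of_isClosed_subset
      ((hcu.inf hcv).preimage_isClosed_of_isClosed isClosed_Icc isClosed_Iic) inter_subset_left
  obtain ⟨t, ⟨htI, ht⟩, hmax⟩ := hcomp.exists_isGreatest ⟨a, left_mem_Icc.2 hab, hcon'⟩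
  have hpos : ∀ y ∈ Ioc t b, 0 < u y ∧ 0 < v y := by
    intro y hy
    by_contra h
    have : y ≤ t := hmax ⟨⟨htI.1.trans hy.1.le, hy.2⟩, by
      by_contra h'
      exact h (lt_min_iff.1 (not_le.1 h'))⟩
    exact absurd hy.1 (not_lt.2 this)
  have htb : t < b := by
    refine lt_of_le_of_ne htI.2 ?_
    rintro rfl
    exact absurd (lt_min hub hvb) (not_lt.2 ht)
  have hsub : Icc t b ⊆ Icc a b := Icc_subset_Icc_left htI.1
  have hbd : ∀ y ∈ Ioo t b, u' y < N * u y ∧ v' y < N * v y := fun y hy =>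
    hlt y ⟨htI.1.trans_lt hy.1, hy.2⟩ (hpos y ⟨hy.1, hy.2.le⟩).1 (hpos y ⟨hy.1, hy.2.le⟩).2
  have hut := mul_exp_lt_of_deriv_lt_mul htb (hcu.mono hsub)
    (fun y hy => hu y (hsub (Ioo_subset_Icc_self hy))) (fun y hy => (hbd y hy).1)
  have hvt := mul_exp_lt_of_deriv_lt_mul htb (hcv.mono hsub)
    (fun y hy => hv y (hsub (Ioo_subset_Icc_self hy))) (fun y hy => (hbd y hy).2)
  have hu0 : 0 < u t := pos_of_mul_pos_left
    ((mul_pos hub (Real.exp_pos _)).trans hut) (Real.exp_pos _).le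
  have hv0 : 0 < v t := pos_of_mul_pos_left
    ((mul_pos hvb (Real.exp_pos _)).trans hvt) (Real.exp_pos _).le
  exact absurd (lt_min hu0 hv0) (not_lt.2 ht)

/-- A function whose derivative is below `M f` with `M ≥ -N`, vanishing at the right end point,
is positive at the left end point. -/
theorem pos_left_of_deriv_lt_mul {f f' M : ℝ → ℝ} {a b N : ℝ} (hab : a < b)
    (hd : ∀ y ∈ Icc a b, HasDerivAt f (f' y) y) (hlt : ∀ y ∈ Ico a b, f' y < M y * f y)
    (hM : ∀ y ∈ Ico a b, -N ≤ M y) (hb : f b = 0) : 0 < f a := by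
  have hc : ContinuousOn f (Icc a b) := fun y hy => (hd y hy).continuousAt.continuousWithinAt
  by_contra! ha
  have hle : ∀ y ∈ Icc a b, f y ≤ 0 := fun y hy =>
    image_le_of_deriv_right_lt_deriv_boundary (B := fun _ => 0) (B' := fun _ => 0) hc
      (fun y hy => (hd y (Ico_subset_Icc_self hy)).hasDerivWithinAt) ha
      (fun y => hasDerivAt_const y 0)
      (fun y hy h => by simpa [h] using hlt y hy) hy
  have := mul_exp_lt_of_deriv_lt_mul (N := -N) hab hc
    (fun y hy => hd y (Ioo_subset_Icc_self hy)) (fun y hy =>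
      (hlt y (Ioo_subset_Ico_self hy)).trans_le (mul_le_mul_of_nonpos_right
        (hM y (Ioo_subset_Ico_self hy)) (hle y (Ioo_subset_Icc_self hy))))
  rw [hb, zero_mul] at this
  exact absurd this (not_lt.2 (mul_nonpos_of_nonpos_of_nonneg ha (Real.exp_pos _).le))

/-- A function with positive derivative on an interval increases strictly between its end points. -/
theorem lt_right_of_deriv_pos {f f' : ℝ → ℝ} {a b : ℝ} (hab : a < b)
    (hd : ∀ y ∈ Icc a b, HasDerivAt f (f' y) y) (hpos : ∀ y ∈ Icc a b, 0 < f' y) :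
    f a < f b :=
  strictMonoOn_of_hasDerivWithinAt_pos (convex_Icc a b)
    (fun y hy => (hd y hy).continuousAt.continuousWithinAt)
    (fun y hy => (hd y (interior_subset hy)).hasDerivWithinAt)
    (fun y hy => hpos y (interior_subset hy))
    (left_mem_Icc.2 hab.le) (right_mem_Icc.2 hab.le) hab

namespace UtilityClass

variable {f f' f'' : ℝ → ℝ}

theorem strictAntiOn_deriv (h : UtilityClass f f' f'') : StrictAntiOn f' (Ioi 0) :=
  strictAntiOn_of_hasDerivWithinAt_neg (convex_Ioi 0)
    (fun x hx => (h.hasDeriv2 x hx).continuousAt.continuousWithinAt)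
    (fun x hx => (h.hasDeriv2 x (interior_subset hx)).hasDerivWithinAt)
    (fun x hx => h.deriv2_neg x (interior_subset hx))

theorem mem_image_deriv (h : UtilityClass f f' f'') {x z : ℝ} (hx : 0 < x) (hz : 0 < z)
    (hxz : x < f' z) : x ∈ f' '' Ioi 0 := by
  obtain ⟨w, hwx, hw⟩ :=
    ((h.tendsto_deriv.eventually_lt_const hx).and (eventually_gt_atTop 0)).exists
  exact isPreconnected_Ioi.intermediate_value (mem_Ioi.2 hw) (mem_Ioi.2 hz)
    (fun x hx => (h.hasDeriv2 x hx).continuousAt.continuousWithinAt) ⟨hwx.le, hxz.le⟩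

theorem exists_lt_deriv {x : ℝ} (hx : (x : EReal) < derivAtZero f') : ∃ z > 0, x < f' z := by
  have := frequently_lt_of_lt_limsup (by isBoundedDefault) hx
  obtain ⟨z, hz, hz0⟩ := (this.and_eventually self_mem_nhdsWithin).exists
  exact ⟨z, hz0, EReal.coe_lt_coe_iff.1 hz⟩

theorem inverse_pos {I : ℝ → ℝ} (hI : InvOn I f' (Ioi 0) (f' '' Ioi 0))
    {x : ℝ} (hx : x ∈ f' '' Ioi 0) : 0 < I x := by
  obtain ⟨z, hz, rfl⟩ := hx
  rw [hI.1 hz]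
  exact hz

theorem inverse_anti (h : UtilityClass f f' f'') {I : ℝ → ℝ}
    (hI : InvOn I f' (Ioi 0) (f' '' Ioi 0)) {x y : ℝ} (hx : x ∈ f' '' Ioi 0)
    (hy : y ∈ f' '' Ioi 0) (hxy : x ≤ y) : I y ≤ I x := by
  obtain ⟨z, hz, rfl⟩ := hx
  obtain ⟨w, hw, rfl⟩ := hy
  rw [hI.1 hz, hI.1 hw]
  exact (h.strictAntiOn_deriv.le_iff_ge hz hw).1 hxy

/-- Every positive number below the threshold `U₊'(c₀ - α)` is a value of `U₊'` on `(0, ∞)`. -/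
theorem mem_image_of_lt_threshold (h : UtilityClass f f' f'') {α c₀ m : ℝ} (hα : 0 < α)
    (hA : ((m : ℝ) : EReal) ≤ ((α : ℝ) : EReal) * derivAtZero f') (hc₀α : α ≤ c₀)
    (hc₀ : c₀ * f' (c₀ - α) - f (c₀ - α) = m) {x : ℝ} (hx : 0 < x) (hlt : x < f' (c₀ - α)) :
    x ∈ f' '' Ioi 0 := by
  rcases hc₀α.lt_or_eq with hc | rfl
  · exact h.mem_image_deriv hx (sub_pos.2 hc) hlt
  · rw [sub_self] at hc₀ hlt
    rw [h.map_zero, sub_zero] at hc₀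
    obtain ⟨z, hz, hxz⟩ := exists_lt_deriv (f' := f') (x := x) (by
      by_contra! hle
      have hmul : (α : EReal) * derivAtZero f' ≤ (α : EReal) * (x : EReal) :=
        mul_le_mul_of_nonneg_left hle (EReal.coe_nonneg.2 hα.le)
      have := hA.trans hmul
      rw [← EReal.coe_mul, EReal.coe_le_coe_iff, ← hc₀] at this
      exact absurd hlt (not_lt.2 (le_of_mul_le_mul_left this hα)))
    exact h.mem_image_deriv hx hz hxz

end UtilityClass

/-- The second component of the vector field, cleared of the denominator `y`: here
`k = μ² / (2σ²)` and `i` stands for the value of the inverse marginal utility. -/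
theorem second_field_eq {r μ σ ρ δ α y a b i : ℝ} (hμ : 0 < μ) (hσ : 0 < σ) (hρ : 0 < ρ)
    (hy : 0 < y) :
    -(2 * ρ * σ ^ 2 / μ ^ 2) *
      ((1 - b) / y * (μ ^ 2 / (2 * ρ * σ ^ 2) * b - i + (r - δ) / ρ + 1 - α)
        - (r + ρ) / (ρ * a) + δ / (ρ * y)) =
      -(((1 - b) * (μ ^ 2 / (2 * σ ^ 2) * b + (r + ρ - δ) - ρ * (i + α))
        - (r + ρ) * (y * a⁻¹) + δ) / (μ ^ 2 / (2 * σ ^ 2) * y)) := by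
  rw [div_eq_mul_inv (r + ρ), mul_inv]
  generalize a⁻¹ = w
  field_simp
  ring

/-- Algebraic core of the barrier property of the line `Ψ`: the slope of the line, `p` being its
height at `z = y / φ₀`, minus the field at height `s` is less than a multiple of `p - s`. -/
theorem barrier_aux {k A δ l z p s w e : ℝ} (hk : 0 < k) (hA : 0 ≤ A)
    (hl : l < 0) (hroot : k * l ^ 2 - (k + A - δ) * l - δ = 0)
    (hp : p = (l - 1) * (z - 1)) (hp1 : p < 1) (hs : s < 1) (he : 0 ≤ e) (hw : z ≤ w) :
    k * (l - 1) * z + ((1 - s) * (k * s + (A - δ) - e) - A * w + δ) <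
      (A - δ - k + k * (s + p)) * (p - s) := by
  have hkey : k * (l - 1) * z + ((1 - p) * (k * p + (A - δ)) - A * z + δ) =
      k * (1 - p) * (p + l - 1) := by
    have hl1 : l - 1 ≠ 0 := by linarith
    have hz : z = 1 + p / (l - 1) := by rw [hp]; field_simp; ring
    rw [hz]
    field_simp
    linear_combination p * hroot
  have hneg : k * (1 - p) * (p + l - 1) < 0 :=
    mul_neg_of_pos_of_neg (mul_pos hk (by linarith)) (by linarith)
  nlinarith [mul_nonneg hA (sub_nonneg.2 hw), mul_nonneg (sub_nonneg.2 hs.le) he]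

/-- One-sided Lipschitz bound behind the quasimonotonicity of the second component. -/
theorem quasimonotone_aux {k A δ ρ α y a₁ a₂ b₁ b₂ i₁ i₂ : ℝ} (hk : 0 < k) (hA : 0 ≤ A)
    (hδ : 0 < δ) (hρ : 0 < ρ) (hα : 0 < α) (hy : 0 < y) (ha₁ : 0 < a₁) (ha : a₁ < a₂)
    (hi₁ : 0 ≤ i₁) (hi : i₂ ≤ i₁) (hb₂ : b₂ < 1) (hb : b₁ < b₂) :
    ((1 - b₁) * (k * b₁ + (A - δ) - ρ * (i₁ + α)) - A * (y * a₁⁻¹) + δ) -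
      ((1 - b₂) * (k * b₂ + (A - δ) - ρ * (i₂ + α)) - A * (y * a₂⁻¹) + δ) <
      (A + k) * (b₂ - b₁) := by
  have hinv : a₂⁻¹ ≤ a₁⁻¹ := inv_anti₀ ha₁ ha.le
  have h1 : A * (y * a₂⁻¹) ≤ A * (y * a₁⁻¹) := by gcongr
  have h2 : 0 ≤ (1 - b₂) * (ρ * (i₁ - i₂)) :=
    mul_nonneg (by linarith) (mul_nonneg hρ.le (by linarith))
  have h3 : 0 ≤ (b₂ - b₁) * (ρ * (i₁ + α)) := by
    apply mul_nonneg (by linarith)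
    positivity
  have h4 : 0 < (b₂ - b₁) * (k * (2 - b₁ - b₂) + δ) := by
    apply mul_pos (by linarith)
    have : 0 < k * (2 - b₁ - b₂) := mul_pos hk (by linarith)
    linarith
  nlinarith

/-- comparison of solutions of the terminal value problem with different
terminal points: if `γφ₀ < ȳ' < ȳ < φ₀` and `ε(ȳ) < ȳ'`, then `φ_{ȳ'} > φ_{ȳ}` and
`ψ_{ȳ'} > ψ_{ȳ}` on the common existence interval `(max{ε(ȳ), ε(ȳ')}, ȳ']`. -/
theorem comparison_solutions (r μ σ ρ δ α : ℝ)
    (hr : 0 ≤ r) (hμ : 0 < μ) (hσ : 0 < σ) (hρ : 0 < ρ) (hδ : 0 < δ)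
    (hα0 : 0 < α) (hα1 : α ≤ 1)
    (Up Up' Up'' Um Um' Um'' : ℝ → ℝ)
    (hUp : UtilityClass Up Up' Up'') (hUm : UtilityClass Um Um' Um'')
    (hA : ((Um α : ℝ) : EReal) ≤ ((α : ℝ) : EReal) * derivAtZero Up')
    (c₀ φ₀ : ℝ) (hc₀α : α ≤ c₀)
    (hc₀ : c₀ * Up' (c₀ - α) - Up (c₀ - α) = Um α)
    (hφ₀ : φ₀ = Up' (c₀ - α))
    (Iplus : ℝ → ℝ) (hI : Set.InvOn Iplus Up' (Set.Ioi 0) (Up' '' Set.Ioi 0))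
    (lam : ℝ) (hlam : lam < 0)
    (hroot : μ ^ 2 / (2 * σ ^ 2) * lam ^ 2 - (μ ^ 2 / (2 * σ ^ 2) + r + ρ - δ) * lam - δ = 0)
    -- the vector field `(g₁, g₂)` and the terminal data function `Ψ`
    (g1 g2 : ℝ → ℝ → ℝ → ℝ)
    (hg1 : ∀ y a b, g1 y a b = a * (1 - b) / y)
    (hg2 : ∀ y a b, g2 y a b = -(2 * ρ * σ ^ 2 / μ ^ 2) *
      ((1 - b) / y * (μ ^ 2 / (2 * ρ * σ ^ 2) * b - Iplus a + (r - δ) / ρ + 1 - α)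
        - (r + ρ) / (ρ * a) + δ / (ρ * y)))
    (Ψ : ℝ → ℝ) (hΨ : ∀ y, Ψ y = (lam - 1) / φ₀ * (y - φ₀))
    -- terminal points `ȳ = ybar` and `ȳ' = ybar'` with `γφ₀ < ȳ' < ȳ < φ₀`
    (ybar ybar' : ℝ)
    (h1 : lam / (lam - 1) * φ₀ < ybar') (h2 : ybar' < ybar) (h3 : ybar < φ₀)
    -- the solution `(φ₁, ψ₁)` with terminal point `ȳ`, on `(ε(ȳ), ȳ]` inside `𝒟`
    (eps1 : ℝ) (φ1 ψ1 : ℝ → ℝ) (heps1 : eps1 < ybar)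
    (hmem1 : ∀ y ∈ Set.Ioc eps1 ybar, 0 < y ∧ 0 < φ1 y ∧ 0 < ψ1 y ∧ ψ1 y < 1)
    (hsol1 : ∀ y ∈ Set.Ioc eps1 ybar,
      HasDerivAt φ1 (g1 y (φ1 y) (ψ1 y)) y ∧ HasDerivAt ψ1 (g2 y (φ1 y) (ψ1 y)) y)
    (hterm1 : φ1 ybar = φ₀ ∧ ψ1 ybar = Ψ ybar)
    -- the solution `(φ₂, ψ₂)` with terminal point `ȳ'`, on `(ε(ȳ'), ȳ']` inside `𝒟`
    (eps2 : ℝ) (φ2 ψ2 : ℝ → ℝ) (heps2 : eps2 < ybar')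
    (hmem2 : ∀ y ∈ Set.Ioc eps2 ybar', 0 < y ∧ 0 < φ2 y ∧ 0 < ψ2 y ∧ ψ2 y < 1)
    (hsol2 : ∀ y ∈ Set.Ioc eps2 ybar',
      HasDerivAt φ2 (g1 y (φ2 y) (ψ2 y)) y ∧ HasDerivAt ψ2 (g2 y (φ2 y) (ψ2 y)) y)
    (hterm2 : φ2 ybar' = φ₀ ∧ ψ2 ybar' = Ψ ybar')
    -- the hypothesis `ε(ȳ) < ȳ'`
    (hE : eps1 < ybar') :
    ∀ y, max eps1 eps2 < y → y ≤ ybar' → φ1 y < φ2 y ∧ ψ1 y < ψ2 y := by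
  have hk : 0 < μ ^ 2 / (2 * σ ^ 2) := by positivity
  set k := μ ^ 2 / (2 * σ ^ 2)
  have hA0 : 0 < r + ρ := by linarith
  have hroot' : k * lam ^ 2 - (k + (r + ρ) - δ) * lam - δ = 0 := by
    linear_combination hroot
  have hφpos : 0 < φ₀ := hterm1.1 ▸ (hmem1 ybar ⟨heps1, le_rfl⟩).2.1
  have hg2' : ∀ y a b, 0 < y → g2 y a b =
      -(((1 - b) * (k * b + (r + ρ - δ) - ρ * (Iplus a + α)) - (r + ρ) * (y * a⁻¹) + δ)
        / (k * y)) := fun y a b hy => by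
    rw [hg2, second_field_eq hμ hσ hρ hy]
  have himage : ∀ x, 0 < x → x < φ₀ → x ∈ Up' '' Ioi 0 := fun x hx hlt =>
    hUp.mem_image_of_lt_threshold hα0 hA hc₀α hc₀ hx (hφ₀ ▸ hlt)
  have hbelow : ∀ (e b : ℝ) (φ ψ : ℝ → ℝ),
      (∀ y ∈ Ioc e b, 0 < y ∧ 0 < φ y ∧ 0 < ψ y ∧ ψ y < 1) →
      (∀ y ∈ Ioc e b, HasDerivAt φ (g1 y (φ y) (ψ y)) y) → φ b = φ₀ →
      ∀ y ∈ Ioo e b, φ y < φ₀ := by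
    intro e b φ ψ hmem hsol hb y hy
    rw [← hb]
    have hsub : Icc y b ⊆ Ioc e b := fun z hz => ⟨hy.1.trans_le hz.1, hz.2⟩
    refine lt_right_of_deriv_pos hy.2 (fun z hz => hsol z (hsub hz)) fun z hz => ?_
    obtain ⟨h0, h1, -, h3⟩ := hmem z (hsub hz)
    rw [hg1]
    exact div_pos (mul_pos h1 (by linarith)) h0
  have hbelow1 := hbelow eps1 ybar φ1 ψ1 hmem1 (fun y hy => (hsol1 y hy).1) hterm1.1
  have hbelow2 := hbelow eps2 ybar' φ2 ψ2 hmem2 (fun y hy => (hsol2 y hy).1) hterm2.1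
  have hφb : φ1 ybar' < φ2 ybar' := by
    rw [hterm2.1]
    exact hbelow1 ybar' ⟨hE, h2⟩
  have hy'pos : 0 < ybar' := (hmem1 ybar' ⟨hE, h2.le⟩).1
  have hψb : ψ1 ybar' < ψ2 ybar' := by
    rw [hterm2.2]
    have hderiv : ∀ y ∈ Icc ybar' ybar, HasDerivAt (fun y => Ψ y - ψ1 y)
        ((lam - 1) / φ₀ - g2 y (φ1 y) (ψ1 y)) y := by
      intro y hy
      have hlin : HasDerivAt Ψ ((lam - 1) / φ₀) y := by
        rw [funext hΨ]
        simpa using ((hasDerivAt_id y).sub_const φ₀).const_mul ((lam - 1) / φ₀)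
      exact hlin.sub (hsol1 y ⟨hE.trans_le hy.1, hy.2⟩).2
    have hΨmem : ∀ y ∈ Ico ybar' ybar, 0 < Ψ y ∧ Ψ y < 1 := by
      intro y hy
      have hl1 : 0 < 1 - lam := by linarith
      rw [hΨ, div_mul_eq_mul_div, div_lt_one hφpos]
      refine ⟨div_pos (mul_pos_of_neg_of_neg (by linarith) (by linarith [hy.2])) hφpos, ?_⟩
      have hγ : lam / (lam - 1) * φ₀ < y := h1.trans_le hy.1
      rw [div_mul_eq_mul_div, div_lt_iff_of_neg (by linarith)] at hγ
      nlinarith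
    refine sub_pos.1 (pos_left_of_deriv_lt_mul (f := fun y => Ψ y - ψ1 y)
      (M := fun y => (r + ρ - δ - k + k * (ψ1 y + Ψ y)) / (k * y))
      (N := (δ + k) / (k * ybar')) h2 hderiv ?_ ?_ (by simp [hterm1.2]))
    · intro y hy
      have hy1 : y ∈ Ioo eps1 ybar := ⟨hE.trans_le hy.1, hy.2⟩
      obtain ⟨h0, hφ, hψ0, hψ1⟩ := hmem1 y ⟨hy1.1, hy1.2.le⟩
      have hI0 := UtilityClass.inverse_pos hI (himage _ hφ (hbelow1 y hy1))
      have hbar := barrier_aux (z := y / φ₀) (w := y * (φ1 y)⁻¹) (e := ρ * (Iplus (φ1 y) + α))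
        hk hA0.le hlam hroot' (p := Ψ y) (by rw [hΨ]; field_simp) (hΨmem y hy).2 hψ1
        (by positivity)
        (by rw [div_eq_mul_inv]; gcongr; exact (hbelow1 y hy1).le)
      have hky : 0 < k * y := by positivity
      rw [hg2' _ _ _ h0, sub_neg_eq_add, div_mul_eq_mul_div _ (k * y), lt_div_iff₀ hky, add_mul,
        div_mul_cancel₀ _ hky.ne']
      refine lt_of_eq_of_lt ?_ hbar
      ring
    · intro y hy
      have hy0 : 0 < y := hy'pos.trans_le hy.1
      have hψ0 := (hmem1 y ⟨hE.trans_le hy.1, hy.2.le⟩).2.2.1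
      have hΨ0 := (hΨmem y hy).1
      have hstep : (δ + k) / (k * y) ≤ (δ + k) / (k * ybar') := by
        gcongr
        exact hy.1
      refine (neg_le_neg hstep).trans ?_
      rw [← neg_div]
      gcongr
      have : 0 < k * (ψ1 y + Ψ y) := by positivity
      linarith
  intro y₀ hy₀ hy₀b
  have he1 : eps1 < y₀ := (le_max_left _ _).trans_lt hy₀
  have he2 : eps2 < y₀ := (le_max_right _ _).trans_lt hy₀
  have hm1 : ∀ y ∈ Icc y₀ ybar', y ∈ Ioc eps1 ybar := fun y hy =>
    ⟨he1.trans_le hy.1, hy.2.trans h2.le⟩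
  have hm2 : ∀ y ∈ Icc y₀ ybar', y ∈ Ioc eps2 ybar' := fun y hy => ⟨he2.trans_le hy.1, hy.2⟩
  have hy₀pos : 0 < y₀ := (hmem2 y₀ ⟨he2, hy₀b⟩).1
  have hmain := pos_of_pos_right (u := fun y => φ2 y - φ1 y) (v := fun y => ψ2 y - ψ1 y)
    (N := (r + ρ + k) / (k * y₀)) hy₀b
    (fun y hy => (hsol2 y (hm2 y hy)).1.sub (hsol1 y (hm1 y hy)).1)
    (fun y hy => (hsol2 y (hm2 y hy)).2.sub (hsol1 y (hm1 y hy)).2)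
    ?_ (sub_pos.2 hφb) (sub_pos.2 hψb)
  · exact ⟨sub_pos.1 hmain.1, sub_pos.1 hmain.2⟩
  intro y hy hu hv
  have hyI : y ∈ Icc y₀ ybar' := Ioo_subset_Icc_self hy
  obtain ⟨hy0, hφ1, hψ1, hψ1'⟩ := hmem1 y (hm1 y hyI)
  obtain ⟨-, hφ2, hψ2, hψ2'⟩ := hmem2 y (hm2 y hyI)
  have hky : 0 < k * y := by positivity
  have hN : (r + ρ + k) / (k * y) ≤ (r + ρ + k) / (k * y₀) := by
    gcongr
    exact hy.1.le
  have hφmem1 := himage _ hφ1 (hbelow1 y ⟨(hm1 y hyI).1, hy.2.trans h2⟩)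
  have hφmem2 := himage _ hφ2 (hbelow2 y ⟨(hm2 y hyI).1, hy.2⟩)
  constructor
  · refine lt_of_lt_of_le ?_ (mul_le_mul_of_nonneg_right hN hu.le)
    have hlt : 1 / y ≤ (r + ρ + k) / (k * y) := by
      rw [div_le_div_iff₀ hy0 hky]
      linarith [mul_pos hA0 hy0]
    refine lt_of_lt_of_le ?_ (mul_le_mul_of_nonneg_right hlt hu.le)
    rw [hg1, hg1, ← sub_div, div_mul_eq_mul_div, div_lt_div_iff_of_pos_right hy0]
    linarith [mul_pos hφ1 hv, mul_pos hu hψ2]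
  · refine lt_of_lt_of_le ?_ (mul_le_mul_of_nonneg_right hN hv.le)
    rw [hg2' _ _ _ hy0, hg2' _ _ _ hy0, neg_sub_neg, ← sub_div, div_mul_eq_mul_div _ (k * y),
      div_lt_div_iff_of_pos_right hky]
    exact quasimonotone_aux hk hA0.le hδ hρ hα0 hy0 hφ1 (sub_pos.1 hu)
      (UtilityClass.inverse_pos hI hφmem1).le
      (hUp.inverse_anti hI hφmem1 hφmem2 (sub_pos.1 hu).le) hψ2' (sub_pos.1 hv)
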